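/- Let A ∈ ℝ^{n×n}, C ∈ ℝ^{m×n}, N ≥ 1 with W := [Cᵀ, AᵀCᵀ, …, A^{(N−1)T}Cᵀ]ᵀ of full column rank n, and R ∈ ℝ^{m×m} symmetric positive definite. Consider the observer z^+ = A η, x̂ = A^{N−1} z with η = argmin_ξ J(ξ, z, y), where J(ξ, z, y) := ‖C A^{N−1} ξ − y‖²_R + Σ_{i=0}^{N−2} ‖C A^i ξ − C A^i z‖²_R. Then the state estimate obeys the classic linear observer recursion x̂^+ = A x̂ + L (y − C x̂) with observer gain L = A^N (Σ_{i=0}^{N−1} A^{iT} Cᵀ R C A^i)^{−1} A^{(N−1)T} Cᵀ R. -/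

import Mathlib

open Matrix Filter Finset

/-- `‖v‖²_R = vᵀ R v`. -/
noncomputable def quadForm {m : ℕ} (R : Matrix (Fin m) (Fin m) ℝ) (v : Fin m → ℝ) : ℝ :=
  v ⬝ᵥ R.mulVec v

/-- The cost `J(ξ, z, y) = ‖C A^{N-1} ξ - y‖²_R + Σ_{i=0}^{N-2} ‖C A^i ξ - C A^i z‖²_R`. -/
noncomputable def Jcost {n m : ℕ} (A : Matrix (Fin n) (Fin n) ℝ) (C : Matrix (Fin m) (Fin n) ℝ)
    (R : Matrix (Fin m) (Fin m) ℝ) (N : ℕ) (ξ z : Fin n → ℝ) (y : Fin m → ℝ) : ℝ :=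
  quadForm R ((C * A ^ (N - 1)).mulVec ξ - y) +
    ∑ i ∈ Finset.range (N - 1), quadForm R ((C * A ^ i).mulVec ξ - (C * A ^ i).mulVec z)

/-- The observer gain `L = A^N (Σ_{i=0}^{N-1} A^{iT} Cᵀ R C A^i)⁻¹ A^{(N-1)T} Cᵀ R`. -/
noncomputable def Lgain {n m : ℕ} (A : Matrix (Fin n) (Fin n) ℝ) (C : Matrix (Fin m) (Fin n) ℝ)
    (R : Matrix (Fin m) (Fin m) ℝ) (N : ℕ) : Matrix (Fin n) (Fin m) ℝ :=
  A ^ N * (∑ i ∈ Finset.range N, (A ^ i)ᵀ * Cᵀ * R * C * A ^ i)⁻¹ * (A ^ (N - 1))ᵀ * Cᵀ * R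

theorem quadForm_add_smul {m : ℕ} {R : Matrix (Fin m) (Fin m) ℝ} (hR : Rᵀ = R)
    (v w : Fin m → ℝ) (t : ℝ) :
    quadForm R (v + t • w) =
      quadForm R w * (t * t) + 2 * (w ⬝ᵥ R *ᵥ v) * t + quadForm R v := by
  have hsymm : v ⬝ᵥ R *ᵥ w = w ⬝ᵥ R *ᵥ v := by
    simpa only [hR] using dotProduct_transpose_mulVec R v w
  simp only [quadForm, mulVec_add, mulVec_smul, add_dotProduct, dotProduct_add, smul_dotProduct,
    dotProduct_smul, smul_eq_mul, hsymm]
  ring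

theorem quadForm_nonneg {m : ℕ} {R : Matrix (Fin m) (Fin m) ℝ} (hR : R.PosDef)
    (v : Fin m → ℝ) : 0 ≤ quadForm R v := by
  simpa [quadForm] using hR.posSemidef.dotProduct_mulVec_nonneg v

theorem eq_zero_of_quadForm_eq_zero {m : ℕ} {R : Matrix (Fin m) (Fin m) ℝ} (hR : R.PosDef)
    {v : Fin m → ℝ} (hv : quadForm R v = 0) : v = 0 := by
  by_contra h
  have := hR.dotProduct_mulVec_pos h
  rw [star_trivial] at this
  exact this.ne' hv

/-- The normal equations satisfied by a minimizer of a weighted least-squares cost. -/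
theorem normal_equations_of_isMin {ι : Type*} {n m : ℕ} {R : Matrix (Fin m) (Fin m) ℝ}
    (hR : Rᵀ = R) (s : Finset ι) (M : ι → Matrix (Fin m) (Fin n) ℝ) (b : ι → Fin m → ℝ)
    {η : Fin n → ℝ}
    (hη : ∀ ξ, ∑ i ∈ s, quadForm R (M i *ᵥ η - b i) ≤ ∑ i ∈ s, quadForm R (M i *ᵥ ξ - b i)) :
    ∑ i ∈ s, (M i)ᵀ *ᵥ R *ᵥ (M i *ᵥ η - b i) = 0 := by
  refine dotProduct_eq_zero _ fun d => ?_
  have hdisc : ∀ t : ℝ, 0 ≤ (∑ i ∈ s, quadForm R (M i *ᵥ d)) * (t * t) +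
      (2 * ∑ i ∈ s, (M i *ᵥ d) ⬝ᵥ R *ᵥ (M i *ᵥ η - b i)) * t + 0 := by
    intro t
    have h := hη (η + t • d)
    have hexp : ∀ i, M i *ᵥ (η + t • d) - b i = (M i *ᵥ η - b i) + t • M i *ᵥ d := by
      intro i
      rw [mulVec_add, mulVec_smul]
      abel
    simp only [hexp, quadForm_add_smul hR, sum_add_distrib, ← sum_mul, ← mul_sum] at h
    linarith
  have hsq := discrim_le_zero hdisc
  rw [discrim, mul_zero, sub_zero] at hsq
  have hzero := pow_eq_zero_iff two_ne_zero |>.mp (le_antisymm hsq (sq_nonneg _))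
  rw [sum_dotProduct]
  calc ∑ i ∈ s, ((M i)ᵀ *ᵥ R *ᵥ (M i *ᵥ η - b i)) ⬝ᵥ d
      = ∑ i ∈ s, (M i *ᵥ d) ⬝ᵥ R *ᵥ (M i *ᵥ η - b i) := by
        refine sum_congr rfl fun i _ => ?_
        rw [dotProduct_comm, dotProduct_transpose_mulVec, dotProduct_comm]
    _ = 0 := by linarith

theorem mulVec_injective_of_rank_eq_card {ι κ K : Type*} [Fintype ι] [Fintype κ] [Field K]
    {W : Matrix ι κ K} (hW : W.rank = Fintype.card κ) : Function.Injective W.mulVec := by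
  have h := W.mulVecLin.finrank_range_add_finrank_ker
  rw [← Matrix.rank, hW, Module.finrank_fintype_fun_eq_card] at h
  have hker : Module.finrank K (LinearMap.ker W.mulVecLin) = 0 := by omega
  exact LinearMap.ker_eq_bot.mp (Submodule.finrank_eq_zero.mp hker)

/-- The Gram matrix of a weighted least-squares problem is invertible when the regressors
jointly separate points. -/
theorem isUnit_sum_transpose_mul_mul {ι : Type*} {n m : ℕ} {R : Matrix (Fin m) (Fin m) ℝ}
    (hR : R.PosDef) (s : Finset ι) (M : ι → Matrix (Fin m) (Fin n) ℝ)
    (hM : ∀ v, (∀ i ∈ s, M i *ᵥ v = 0) → v = 0) :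
    IsUnit (∑ i ∈ s, (M i)ᵀ * R * M i) := by
  rw [← mulVec_injective_iff_isUnit]
  refine (injective_iff_map_eq_zero (∑ i ∈ s, (M i)ᵀ * R * M i).mulVecLin).mpr fun v hv => ?_
  rw [mulVecLin_apply] at hv
  have hsum : ∑ i ∈ s, quadForm R (M i *ᵥ v) = 0 := by
    calc ∑ i ∈ s, quadForm R (M i *ᵥ v)
        = v ⬝ᵥ (∑ i ∈ s, (M i)ᵀ * R * M i) *ᵥ v := by
          rw [sum_mulVec, dotProduct_sum]
          refine sum_congr rfl fun i _ => ?_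
          rw [← mulVec_mulVec, ← mulVec_mulVec, dotProduct_transpose_mulVec, dotProduct_comm,
            quadForm]
      _ = 0 := by rw [hv, dotProduct_zero]
  rw [sum_eq_zero_iff_of_nonneg fun i _ => quadForm_nonneg hR _] at hsum
  exact hM v fun i hi => eq_zero_of_quadForm_eq_zero hR (hsum i hi)

/-- **The optimal observer has the classic linear observer structure
(eqn. `eqn:optimalL`).** With `x̂ = A^{N-1} z`, `z⁺ = A η`, `η = argmin_ξ J(ξ, z, y)`,
the next estimate is `x̂⁺ = A x̂ + L (y - C x̂)`. -/
theorem stmt_7 {n m : ℕ} (A : Matrix (Fin n) (Fin n) ℝ) (C : Matrix (Fin m) (Fin n) ℝ)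
    (N : ℕ) (hN : 1 ≤ N)
    (hW : (Matrix.of fun (p : Fin N × Fin m) (j : Fin n) =>
      (C * A ^ (p.1 : ℕ)) p.2 j).rank = n)
    (R : Matrix (Fin m) (Fin m) ℝ) (hR : R.PosDef)
    (z : Fin n → ℝ) (y : Fin m → ℝ) (η : Fin n → ℝ)
    (hη : ∀ ξ : Fin n → ℝ, Jcost A C R N η z y ≤ Jcost A C R N ξ z y) :
    (A ^ (N - 1)).mulVec (A.mulVec η) =
      A.mulVec ((A ^ (N - 1)).mulVec z) +
        (Lgain A C R N).mulVec (y - C.mulVec ((A ^ (N - 1)).mulVec z)) := by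
  obtain ⟨k, rfl⟩ : ∃ k, N = k + 1 := ⟨N - 1, by omega⟩
  have hRt : Rᵀ = R := by simpa using hR.isHermitian.eq
  set M : ℕ → Matrix (Fin m) (Fin n) ℝ := fun i => C * A ^ i with hM
  set S := ∑ i ∈ range (k + 1), (M i)ᵀ * R * M i with hS
  have hSL : ∑ i ∈ range (k + 1), (A ^ i)ᵀ * Cᵀ * R * C * A ^ i = S := by
    simp only [hS, hM, transpose_mul, Matrix.mul_assoc]
  have hunit : IsUnit S := by
    refine isUnit_sum_transpose_mul_mul hR _ M fun v hv => ?_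
    refine mulVec_injective_of_rank_eq_card (hW.trans (Fintype.card_fin n).symm) ?_
    rw [mulVec_zero]
    ext p
    exact congrFun (hv p.1 (mem_range.mpr p.1.2)) p.2
  set b : ℕ → Fin m → ℝ := fun i => if i = k then y else M i *ᵥ z with hb
  have hJ : ∀ ξ, Jcost A C R (k + 1) ξ z y =
      ∑ i ∈ range (k + 1), quadForm R (M i *ᵥ ξ - b i) := by
    intro ξ
    rw [Jcost, Nat.add_sub_cancel, sum_range_succ, add_comm]
    congr 1
    · refine sum_congr rfl fun i hi => ?_
      simp [hb, hM, (mem_range.mp hi).ne]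
    · simp [hb, hM]
  have hnormal := normal_equations_of_isMin hRt (range (k + 1)) M b
    fun ξ => by simpa only [hJ] using hη ξ
  have hsolve : S *ᵥ (η - z) = (M k)ᵀ *ᵥ R *ᵥ (y - M k *ᵥ z) := by
    have hshift : ∑ i ∈ range (k + 1), (M i)ᵀ *ᵥ R *ᵥ (b i - M i *ᵥ z) =
        (M k)ᵀ *ᵥ R *ᵥ (y - M k *ᵥ z) := by
      rw [sum_eq_single_of_mem k (self_mem_range_succ k) fun i _ hi => by simp [hb, hi]]
      simp [hb]
    rw [← hshift, ← sub_eq_zero, ← hnormal, hS, sum_mulVec, ← sum_sub_distrib]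
    refine sum_congr rfl fun i _ => ?_
    simp only [← mulVec_mulVec, ← mulVec_sub]
    congr 2
    rw [mulVec_sub]
    abel
  have hdiff : η - z = S⁻¹ *ᵥ (M k)ᵀ *ᵥ R *ᵥ (y - M k *ᵥ z) := by
    rw [← hsolve, mulVec_mulVec, nonsing_inv_mul _ ((isUnit_iff_isUnit_det S).mp hunit),
      one_mulVec]
  have hgain : (Lgain A C R (k + 1)) *ᵥ (y - C *ᵥ A ^ k *ᵥ z) = A ^ (k + 1) *ᵥ (η - z) := by
    rw [hdiff, Lgain, hSL, Nat.add_sub_cancel]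
    simp only [hM, transpose_mul, ← mulVec_mulVec]
  rw [Nat.add_sub_cancel, hgain, mulVec_mulVec, mulVec_mulVec, ← pow_succ, ← pow_succ', mulVec_sub]
  abel
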